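/- There exist constants β_min, τ_max > 0 depending only on Ω such that for all θ⋆ ∈ D and all λ ∈ [λ_min, λ_max]: β_min ≤ β⋆(λ) and σ ≤ τ⋆(λ) ≤ τ_max; moreover, if δ ∈ (0,1) then β⋆(λ) < β_max := λ_max/α_min(δ), where α_min(δ) is the unique positive solution of (1+α²)Φ(−α) − αφ(α) = δ/2. -/

import Mathlib

open MeasureTheory ProbabilityTheory
open scoped ENNReal NNReal

noncomputable section

/-- Standard Gaussian density φ. -/
def gphi (x : ℝ) : ℝ := Real.exp (-x ^ 2 / 2) / Real.sqrt (2 * Real.pi)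

/-- Standard Gaussian CDF Φ. -/
def gPhi (x : ℝ) : ℝ := ∫ t in Set.Iic x, gphi t

/-- Soft thresholding η(x; b) = sign(x)(|x| − b)₊. -/
def eta (x b : ℝ) : ℝ := Real.sign x * max (|x| - b) 0

/-- Derivative in x of soft thresholding: η′(x; b) = 1_{|x| > b}. -/
def eta' (x b : ℝ) : ℝ := if b < |x| then 1 else 0

/-- The ℓ_p ball F_p(ξ) = {x : (1/N) ∑ |xᵢ|^p ≤ ξ^p}. -/
def Fball (N : ℕ) (p ξ : ℝ) : Set (Fin N → ℝ) :=
  {x | (1 / (N : ℝ)) * ∑ i, |x i| ^ p ≤ ξ ^ p}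

/-- Number of nonzero entries ‖x‖₀. -/
def l0 {N : ℕ} (x : Fin N → ℝ) : ℕ := (Finset.univ.filter fun i => x i ≠ 0).card

/-- The ℓ₀ ball F_0(s) = {x : ‖x‖₀ ≤ sN}. -/
def F0ball (N : ℕ) (s : ℝ) : Set (Fin N → ℝ) := {x | (l0 x : ℝ) ≤ s * N}

/-- The critical sparsity s_max(δ). -/
def smax (δ : ℝ) : ℝ :=
  δ * sSup ((fun α : ℝ =>
      (1 - (2 / δ) * ((1 + α ^ 2) * gPhi (-α) - α * gphi α)) /
      (1 + α ^ 2 - 2 * ((1 + α ^ 2) * gPhi (-α) - α * gphi α))) '' Set.Ici 0)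

/-- Empirical distribution of the entries of a vector. -/
def empDist {N : ℕ} (θ : Fin N → ℝ) : Measure ℝ :=
  ((N : ℝ≥0∞))⁻¹ • ∑ i : Fin N, Measure.dirac (θ i)

/-- Empirical distribution of pairs of entries of two vectors. -/
def empDist2 {N : ℕ} (u v : Fin N → ℝ) : Measure (ℝ × ℝ) :=
  ((N : ℝ≥0∞))⁻¹ • ∑ i : Fin N, Measure.dirac (u i, v i)

/-- Squared order-2 Wasserstein distance between measures on ℝ². -/
def W2sq (μ ν : Measure (ℝ × ℝ)) : ℝ :=
  sInf {r : ℝ | ∃ γ : Measure ((ℝ × ℝ) × (ℝ × ℝ)),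
    γ.map Prod.fst = μ ∧ γ.map Prod.snd = ν ∧
    r = ∫ q, ((q.1.1 - q.2.1) ^ 2 + (q.1.2 - q.2.2) ^ 2) ∂γ}

/-- Order-2 Wasserstein distance. -/
def W2 (μ ν : Measure (ℝ × ℝ)) : ℝ := Real.sqrt (W2sq μ ν)

/-- Standard Gaussian measure on ℝ. -/
def stdG : Measure ℝ := gaussianReal 0 1

/-- The state-evolution fixed point equations (for (Θ,Z) ∼ μ ⊗ N(0,1)),
together with positivity of (β, τ). -/
def StateEvo (δ σ : ℝ) (μ : Measure ℝ) (lam β τ : ℝ) : Prop :=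
  0 < β ∧ 0 < τ ∧
  τ ^ 2 = σ ^ 2 + (1 / δ) *
    ∫ q : ℝ × ℝ, (eta (q.1 + τ * q.2) (τ * lam / β) - q.1) ^ 2 ∂(μ.prod stdG) ∧
  β = τ * (1 - (1 / δ) *
    ∫ q : ℝ × ℝ, eta' (q.1 + τ * q.2) (τ * lam / β) ∂(μ.prod stdG))

/-- s⋆ = P(|Θ + τZ| ≥ ατ) for (Θ,Z) ∼ μ ⊗ N(0,1). -/
def sStar (μ : Measure ℝ) (τ α : ℝ) : ℝ :=
  ((μ.prod stdG) {q : ℝ × ℝ | α * τ ≤ |q.1 + τ * q.2|}).toReal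

/-- The limit law μ⋆: law of (η(Θ + τZ; ατ), Θ) for (Θ,Z) ∼ μ ⊗ N(0,1). -/
def muStar (μ : Measure ℝ) (τ α : ℝ) : Measure (ℝ × ℝ) :=
  (μ.prod stdG).map (fun q => (eta (q.1 + τ * q.2) (α * τ), q.1))

/-- The limit law for the debiased Lasso: law of (Θ + τZ, Θ). -/
def muStarD (μ : Measure ℝ) (τ : ℝ) : Measure (ℝ × ℝ) :=
  (μ.prod stdG).map (fun q => (q.1 + τ * q.2, q.1))

/-- Law of the design matrix: i.i.d. N(0, 1/n) entries. -/
def PX (n N : ℕ) : Measure (Fin n → Fin N → ℝ) :=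
  Measure.pi fun _ => Measure.pi fun _ => gaussianReal 0 ((n : ℝ≥0))⁻¹

/-- Law of the noise: i.i.d. standard Gaussian entries. -/
def Pz (n : ℕ) : Measure (Fin n → ℝ) :=
  Measure.pi fun _ => gaussianReal 0 1

/-- Joint law of (X, z). -/
def Pmodel (n N : ℕ) : Measure ((Fin n → Fin N → ℝ) × (Fin n → ℝ)) :=
  (PX n N).prod (Pz n)

/-- The response y = Xθ⋆ + σz. -/
def yvec {n N : ℕ} (σ : ℝ) (θstar : Fin N → ℝ) (X : Fin n → Fin N → ℝ)
    (z : Fin n → ℝ) : Fin n → ℝ :=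
  fun i => (∑ j, X i j * θstar j) + σ * z i

/-- The Lasso cost (1/(2n))‖y − Xθ‖² + (λ/n)‖θ‖₁. -/
def lassoCost {n N : ℕ} (X : Fin n → Fin N → ℝ) (y : Fin n → ℝ) (lam : ℝ)
    (θ : Fin N → ℝ) : ℝ :=
  (1 / (2 * (n : ℝ))) * ∑ i, (y i - ∑ j, X i j * θ j) ^ 2
    + (lam / (n : ℝ)) * ∑ j, |θ j|

/-- The uniformity class: D is either an ℓ_p ball F_p(ξ) or an ℓ₀ ball F_0(s) with
s below the critical sparsity, with the corresponding exponent q. -/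
def DFamSpec (δ : ℝ) (Dfam : (M : ℕ) → Set (Fin M → ℝ)) (q : ℝ) : Prop :=
  (∃ p ξ : ℝ, 0 < p ∧ 0 < ξ ∧ (∀ M, Dfam M = Fball M p ξ) ∧ q = max (1 / p - 1) 0) ∨
  (∃ s : ℝ, 0 ≤ s ∧ s < smax δ ∧ (∀ M, Dfam M = F0ball M s) ∧ q = 0)

/-! ### Gaussian integrals -/

lemma gphi_eq_gaussianPDFReal : gphi = gaussianPDFReal 0 1 := by
  funext x
  simp [gphi, gaussianPDFReal_def, div_eq_inv_mul]

instance : IsProbabilityMeasure stdG := by unfold stdG; infer_instance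

lemma memLp_id_stdG (p : ℝ≥0∞) (hp : p ≠ ∞) : MemLp (fun z : ℝ => z) p stdG :=
  memLp_id_gaussianReal' p hp

lemma integral_stdG (f : ℝ → ℝ) : ∫ z, f z ∂stdG = ∫ z, gphi z * f z := by
  rw [stdG, integral_gaussianReal_eq_integral_smul one_ne_zero, gphi_eq_gaussianPDFReal]
  rfl

lemma integrable_stdG_iff {f : ℝ → ℝ} :
    Integrable f stdG ↔ Integrable (fun z => gphi z * f z) := by
  rw [stdG, gaussianReal_of_var_ne_zero _ one_ne_zero,
    integrable_withDensity_iff_integrable_smul' (measurable_gaussianPDF 0 1)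
      (Filter.Eventually.of_forall fun _ => gaussianPDF_lt_top)]
  simp only [toReal_gaussianPDF, gphi_eq_gaussianPDFReal, smul_eq_mul]

lemma setIntegral_stdG {s : Set ℝ} (hs : MeasurableSet s) (f : ℝ → ℝ) :
    ∫ z in s, f z ∂stdG = ∫ z in s, gphi z * f z := by
  rw [← integral_indicator hs, integral_stdG, ← integral_indicator hs]
  congr 1
  funext z
  by_cases h : z ∈ s <;> simp [h]

lemma map_neg_stdG : stdG.map (MeasurableEquiv.neg ℝ) = stdG := by
  have := gaussianReal_map_neg (μ := 0) (v := 1)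
  rw [neg_zero] at this
  exact this

lemma integral_comp_neg_stdG (f : ℝ → ℝ) : ∫ z, f (-z) ∂stdG = ∫ z, f z ∂stdG := by
  conv_rhs => rw [← map_neg_stdG]
  rw [integral_map_equiv]
  rfl

lemma integrable_comp_neg_stdG {f : ℝ → ℝ} (hf : Integrable f stdG) :
    Integrable (fun z => f (-z)) stdG := by
  rw [← map_neg_stdG, integrable_map_equiv] at hf
  exact hf

lemma integral_id_stdG : ∫ z : ℝ, z ∂stdG = 0 := integral_id_gaussianReal

lemma integrable_pow_stdG (k : ℕ) : Integrable (fun z : ℝ => z ^ k) stdG := by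
  rcases eq_or_ne k 0 with rfl | hk
  · simp
  · have := (memLp_id_stdG k (by simp)).integrable_norm_pow hk
    refine this.mono (by fun_prop) (Filter.Eventually.of_forall fun z => ?_)
    simp

lemma integrable_id_stdG : Integrable (fun z : ℝ => z) stdG := by
  simpa using integrable_pow_stdG 1

lemma integrable_mul_sub_stdG (u : ℝ) : Integrable (fun z : ℝ => z * (z - u)) stdG := by
  refine ((integrable_pow_stdG 2).sub (integrable_id_stdG.const_mul u)).congr
    (Filter.Eventually.of_forall fun z => ?_)
  simp only [Pi.sub_apply]; ring

lemma integrable_sub_sq_stdG (u : ℝ) : Integrable (fun z : ℝ => (z - u) ^ 2) stdG := by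
  refine ((integrable_mul_sub_stdG u).sub ((integrable_id_stdG.sub (integrable_const u)).const_mul
    u)).congr (Filter.Eventually.of_forall fun z => ?_)
  simp only [Pi.sub_apply]; ring

lemma integral_sq_stdG : ∫ z : ℝ, z ^ 2 ∂stdG = 1 := by
  have h := variance_fun_id_gaussianReal (μ := 0) (v := 1)
  rw [variance_of_integral_eq_zero (by fun_prop) integral_id_gaussianReal] at h
  simpa [stdG] using h

lemma integral_sub_sq_stdG (c : ℝ) : ∫ z : ℝ, (z - c) ^ 2 ∂stdG = 1 + c ^ 2 := by
  have h : (fun z : ℝ => (z - c) ^ 2) = fun z => (z ^ 2 - 2 * c * z) + c ^ 2 := by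
    funext z; ring
  have h1 := integrable_id_stdG
  have h2 : Integrable (fun z : ℝ => z ^ 2 - 2 * c * z) stdG :=
    (integrable_pow_stdG 2).sub (h1.const_mul _)
  rw [h, integral_add h2 (integrable_const _),
    integral_sub (integrable_pow_stdG 2) (h1.const_mul _), integral_const_mul, integral_id_stdG,
    integral_sq_stdG]
  simp

lemma hasDerivAt_gphi (z : ℝ) : HasDerivAt gphi (-(z * gphi z)) z := by
  have h : HasDerivAt (fun z : ℝ => Real.exp (-z ^ 2 / 2) / Real.sqrt (2 * Real.pi))
      (Real.exp (-z ^ 2 / 2) * (-(2 * z) / 2) / Real.sqrt (2 * Real.pi)) z := by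
    refine HasDerivAt.div_const (HasDerivAt.exp ?_) _
    refine HasDerivAt.div_const ?_ _
    simpa using (hasDerivAt_pow 2 z).fun_neg
  refine h.congr_deriv ?_
  simp only [gphi]; ring

lemma integrable_gphi_mul_pow (k : ℕ) : Integrable (fun z => gphi z * z ^ k) :=
  integrable_stdG_iff.1 (integrable_pow_stdG k)

/-- Fundamental theorem of calculus on a half-line with vanishing boundary term at infinity. -/
lemma integral_Ioi_eq_neg {f f' : ℝ → ℝ} (u : ℝ) (hd : ∀ z, HasDerivAt f (f' z) z)
    (hf : Integrable f) (hf' : Integrable f') : ∫ z in Set.Ioi u, f' z = -f u := by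
  have ht := tendsto_zero_of_hasDerivAt_of_integrableOn_Ioi (a := u) (fun z _ => hd z)
    hf'.integrableOn hf.integrableOn
  rw [integral_Ioi_of_hasDerivAt_of_tendsto' (fun z _ => hd z) hf'.integrableOn ht, zero_sub]

lemma setIntegral_Ioi_id_stdG (u : ℝ) : ∫ z in Set.Ioi u, z ∂stdG = gphi u := by
  have hd (z : ℝ) : HasDerivAt (fun z => -gphi z) (gphi z * z) z :=
    (hasDerivAt_gphi z).fun_neg.congr_deriv (by ring)
  rw [setIntegral_stdG measurableSet_Ioi, integral_Ioi_eq_neg u hd, neg_neg]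
  · simpa using (integrable_gphi_mul_pow 0).neg
  · simpa using integrable_gphi_mul_pow 1

lemma setIntegral_Ioi_mul_sub_stdG (u : ℝ) :
    ∫ z in Set.Ioi u, z * (z - u) ∂stdG = ∫ _ in Set.Ioi u, (1 : ℝ) ∂stdG := by
  have h2 := integrable_mul_sub_stdG u
  have hd (z : ℝ) : HasDerivAt (fun z => -((z - u) * gphi z)) (gphi z * (z * (z - u) - 1)) z :=
    (((hasDerivAt_id z).sub_const u).fun_mul (hasDerivAt_gphi z)).fun_neg.congr_deriv
      (by simp only [id]; ring)
  rw [← sub_eq_zero, ← integral_sub h2.integrableOn (integrable_const _),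
    setIntegral_stdG measurableSet_Ioi, integral_Ioi_eq_neg u hd]
  · simp
  · convert ((integrable_gphi_mul_pow 1).sub ((integrable_gphi_mul_pow 0).const_mul u)).neg using 1
    funext z; simp only [Pi.neg_apply, Pi.sub_apply, pow_one, pow_zero]; ring
  · exact integrable_stdG_iff.1 (h2.sub (integrable_const 1))

lemma setIntegral_Ioi_sub_sq_stdG (u : ℝ) :
    ∫ z in Set.Ioi u, (z - u) ^ 2 ∂stdG =
      (1 + u ^ 2) * ∫ _ in Set.Ioi u, (1 : ℝ) ∂stdG - u * gphi u := by
  have i1 := integrable_id_stdG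
  have h2 := integrable_mul_sub_stdG u
  have h : (fun z : ℝ => (z - u) ^ 2) = fun z => z * (z - u) - (u * z - u ^ 2 * 1) := by
    funext z; ring
  have h3 : Integrable (fun z : ℝ => u * z - u ^ 2 * 1) stdG :=
    (i1.const_mul u).sub (integrable_const _)
  rw [h, integral_sub h2.integrableOn h3.integrableOn,
    integral_sub (i1.const_mul u).integrableOn (integrable_const _), integral_const_mul,
    integral_const_mul, setIntegral_Ioi_mul_sub_stdG, setIntegral_Ioi_id_stdG]
  ring

lemma gPhi_neg_eq (u : ℝ) : gPhi (-u) = ∫ _ in Set.Ioi u, (1 : ℝ) ∂stdG := by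
  rw [setIntegral_stdG measurableSet_Ioi, gPhi, ← integral_comp_neg_Ioi]
  simp [gphi]

/-- The risk of soft thresholding at the origin, `E[η(Z; α)²]`. -/
def nullRisk (α : ℝ) : ℝ := ∫ z, (max (|z| - α) 0) ^ 2 ∂stdG

lemma integrable_nullRisk {α : ℝ} (hα : 0 ≤ α) :
    Integrable (fun z : ℝ => (max (|z| - α) 0) ^ 2) stdG := by
  refine (integrable_pow_stdG 2).mono (by fun_prop) (Filter.Eventually.of_forall fun z => ?_)
  simp only [norm_pow, Real.norm_eq_abs]
  refine pow_le_pow_left₀ (abs_nonneg _) ?_ 2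
  rw [abs_of_nonneg (le_max_right _ _)]
  exact max_le (by linarith) (abs_nonneg z)

lemma nullRisk_eq {α : ℝ} (hα : 0 ≤ α) :
    nullRisk α = 2 * ((1 + α ^ 2) * gPhi (-α) - α * gphi α) := by
  set B : ℝ → ℝ := (Set.Ioi α).indicator fun z => (z - α) ^ 2 with hB
  have hi : Integrable B stdG := (integrable_sub_sq_stdG α).indicator measurableSet_Ioi
  have h : (fun z : ℝ => (max (|z| - α) 0) ^ 2) = fun z => B z + B (-z) := by
    funext z
    simp only [hB, Set.indicator_apply, Set.mem_Ioi]
    rcases abs_cases z with ⟨h1, h2⟩ | ⟨h1, h2⟩ <;> rw [h1] <;> split_ifs <;>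
      first
        | (exfalso; linarith)
        | (rw [max_eq_left (by linarith)]; ring)
        | (rw [max_eq_right (by linarith)]; ring)
  rw [nullRisk, h, integral_add hi (integrable_comp_neg_stdG hi), integral_comp_neg_stdG, hB,
    integral_indicator measurableSet_Ioi, setIntegral_Ioi_sub_sq_stdG, gPhi_neg_eq]
  ring

lemma nullRisk_nonneg (α : ℝ) : 0 ≤ nullRisk α := integral_nonneg fun _ => sq_nonneg _

lemma nullRisk_anti {a b : ℝ} (ha : 0 ≤ a) (hab : a ≤ b) : nullRisk b ≤ nullRisk a := by
  refine integral_mono (integrable_nullRisk (ha.trans hab)) (integrable_nullRisk ha) fun z => ?_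
  have : max (|z| - b) 0 ≤ max (|z| - a) 0 := max_le_max_right _ (by linarith)
  exact pow_le_pow_left₀ (le_max_right _ _) this 2

lemma nullRisk_zero : nullRisk 0 = 1 := by
  rw [← integral_sq_stdG, nullRisk]
  simp

lemma nullRisk_le_one {α : ℝ} (hα : 0 ≤ α) : nullRisk α ≤ 1 :=
  nullRisk_zero ▸ nullRisk_anti le_rfl hα

lemma exists_nullRisk_lt {ε : ℝ} (hε : 0 < ε) : ∃ α, 0 < α ∧ nullRisk α < ε := by
  set C := ∫ z : ℝ, z ^ 4 ∂stdG
  have hC : 0 ≤ C := integral_nonneg fun z => by positivity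
  have hb : ∀ α, 1 ≤ α → nullRisk α ≤ C / α := by
    intro α hα
    have hα0 : 0 < α := by linarith
    rw [nullRisk, ← integral_div]
    refine integral_mono (integrable_nullRisk hα0.le) ((integrable_pow_stdG 4).div_const _)
      fun z => ?_
    have h1 : max (|z| - α) 0 ≤ z ^ 2 / α := by
      refine max_le ?_ (by positivity)
      rw [le_div_iff₀ hα0, ← sq_abs z]
      nlinarith [sq_nonneg (|z| - α), sq_nonneg |z|, sq_nonneg α]
    calc (max (|z| - α) 0) ^ 2 ≤ (z ^ 2 / α) ^ 2 := pow_le_pow_left₀ (le_max_right _ _) h1 2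
      _ = z ^ 4 / α / α := by field_simp
      _ ≤ z ^ 4 / α := div_le_self (by positivity) hα
  refine ⟨C / ε + 1, by positivity, (hb _ (by have := div_nonneg hC hε.le; linarith)).trans_lt ?_⟩
  rw [div_lt_iff₀ (by positivity)]
  have : ε * (C / ε + 1) = C + ε := by field_simp
  linarith

/-! ### Soft thresholding of a Gaussian shift -/

lemma eta_eq_sub_clamp (x : ℝ) {b : ℝ} (hb : 0 ≤ b) : eta x b = x - max (-b) (min b x) := by
  unfold eta
  rcases lt_trichotomy x 0 with h | rfl | h
  · rw [Real.sign_of_neg h, abs_of_neg h, min_eq_right (by linarith)]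
    rcases le_total (-x) b with h1 | h1
    · rw [max_eq_right (by linarith), max_eq_right (by linarith)]; ring
    · rw [max_eq_left (by linarith), max_eq_left (by linarith)]; ring
  · simp [hb]
  · rw [Real.sign_of_pos h, abs_of_pos h, max_eq_right (le_min (by linarith) (by linarith))]
    rcases le_total x b with h1 | h1
    · rw [max_eq_right (by linarith), min_eq_right h1]; ring
    · rw [max_eq_left (by linarith), min_eq_left h1]; ring

/-- Variational inequality characterizing soft thresholding as a proximal map. -/
lemma mul_abs_eta_sub_abs_le (x θ : ℝ) {b : ℝ} (hb : 0 ≤ b) :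
    b * (|eta x b| - |θ|) ≤ (x - eta x b) * (eta x b - θ) := by
  set c := max (-b) (min b x) with hc
  have he := eta_eq_sub_clamp x hb
  rw [← hc] at he
  have h1 : |c| ≤ b := abs_le.2 ⟨le_max_left _ _, max_le (by linarith) (min_le_left _ _)⟩
  have h2 : c * (x - c) = b * |x - c| := by
    rcases le_total b x with h | h
    · rw [hc, min_eq_left h, max_eq_right (by linarith), abs_of_nonneg (by linarith)]
    · rw [hc, min_eq_right h]
      rcases le_total (-b) x with h' | h'
      · rw [max_eq_right h']; simp
      · rw [max_eq_left h', abs_of_nonpos (by linarith)]; ring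
  have h3 : c * θ ≤ b * |θ| :=
    (le_abs_self _).trans (by rw [abs_mul]; exact mul_le_mul_of_nonneg_right h1 (abs_nonneg θ))
  rw [he]
  nlinarith

lemma memLp_eta_sub (θ τ : ℝ) {b : ℝ} (hb : 0 ≤ b) :
    MemLp (fun z => eta (θ + τ * z) b - θ) 2 stdG := by
  have h : (fun z => eta (θ + τ * z) b - θ) =
      (fun z => τ * z) - fun z => max (-b) (min b (θ + τ * z)) := by
    funext z
    rw [eta_eq_sub_clamp _ hb, Pi.sub_apply]; ring
  rw [h]
  refine ((memLp_id_stdG 2 (by simp)).const_mul τ).sub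
    (MemLp.of_bound (by fun_prop) b (Filter.Eventually.of_forall fun z => ?_))
  exact abs_le.2 ⟨le_max_left _ _, max_le (by linarith) (min_le_left _ _)⟩

lemma integrable_eta_sub_sq (θ τ : ℝ) {b : ℝ} (hb : 0 ≤ b) :
    Integrable (fun z => (eta (θ + τ * z) b - θ) ^ 2) stdG :=
  (memLp_eta_sub θ τ hb).integrable_sq

lemma integrable_mul_eta_sub (θ τ : ℝ) {b : ℝ} (hb : 0 ≤ b) :
    Integrable (fun z => z * (eta (θ + τ * z) b - θ)) stdG :=
  (memLp_id_stdG 2 (by simp)).integrable_mul (memLp_eta_sub θ τ hb)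

lemma measurable_eta' (b : ℝ) : Measurable fun x => eta' x b :=
  Measurable.ite (measurableSet_lt measurable_const measurable_norm) measurable_const
    measurable_const

lemma integrable_eta' (θ τ b : ℝ) : Integrable (fun z => eta' (θ + τ * z) b) stdG := by
  refine Integrable.of_bound ((measurable_eta' b).comp (by fun_prop)).aestronglyMeasurable 1
    (Filter.Eventually.of_forall fun z => ?_)
  unfold eta'
  split_ifs <;> simp

/-- Gaussian integration by parts for soft thresholding. -/
lemma integral_mul_eta_sub (θ : ℝ) {τ b : ℝ} (hτ : 0 < τ) (hb : 0 < b) :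
    ∫ z, z * (eta (θ + τ * z) b - θ) ∂stdG = τ * ∫ z, eta' (θ + τ * z) b ∂stdG := by
  have i1 := integrable_id_stdG
  set A : ℝ → ℝ → ℝ := fun u => (Set.Ioi u).indicator fun z => z * (z - u) with hA
  set I : ℝ → ℝ → ℝ := fun u => (Set.Ioi u).indicator fun _ => 1 with hI
  have hAi (u : ℝ) : Integrable (A u) stdG :=
    (integrable_mul_sub_stdG u).indicator measurableSet_Ioi
  have hIi (u : ℝ) : Integrable (I u) stdG :=
    (integrable_const _).indicator measurableSet_Ioi
  have hAI (u : ℝ) : ∫ z, A u z ∂stdG = ∫ z, I u z ∂stdG := by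
    rw [hA, hI, integral_indicator measurableSet_Ioi, integral_indicator measurableSet_Ioi,
      setIntegral_Ioi_mul_sub_stdG]
  set u := (b - θ) / τ with hu
  set v := (b + θ) / τ with hv
  have hu' (z : ℝ) : u < z ↔ b < θ + τ * z := by
    rw [hu, div_lt_iff₀ hτ]; constructor <;> intro <;> linarith
  have hv' (z : ℝ) : v < -z ↔ θ + τ * z < -b := by
    rw [hv, div_lt_iff₀ hτ]; constructor <;> intro <;> linarith
  have hτu : τ * u = b - θ := by rw [hu]; field_simp
  have hτv : τ * v = b + θ := by rw [hv]; field_simp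
  have h1 : (fun z => z * (eta (θ + τ * z) b - θ)) =
      fun z => τ * (A u z + A v (-z)) - θ * z := by
    funext z
    rw [eta_eq_sub_clamp _ hb.le]
    simp only [hA, Set.indicator_apply, Set.mem_Ioi, hu', hv']
    split_ifs with h h' h'
    · exfalso; linarith
    · rw [min_eq_left h.le, max_eq_right (by linarith)]
      linear_combination z * hτu
    · rw [min_eq_right (by linarith), max_eq_left h'.le]
      linear_combination (-z) * hτv
    · rw [min_eq_right (by linarith), max_eq_right (by linarith)]; ring
  have h2 : (fun z => eta' (θ + τ * z) b) = fun z => I u z + I v (-z) := by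
    funext z
    simp only [hI, Set.indicator_apply, Set.mem_Ioi, hu', hv', eta', lt_abs]
    split_ifs <;> first | (exfalso; grind) | simp
  have h3 : Integrable (fun z => A u z + A v (-z)) stdG :=
    (hAi u).add (integrable_comp_neg_stdG (hAi v))
  rw [h1, h2, integral_sub (h3.const_mul τ) (i1.const_mul θ), integral_const_mul,
    integral_const_mul, integral_id_stdG,
    integral_add (hAi u) (integrable_comp_neg_stdG (hAi v)),
    integral_add (hIi u) (integrable_comp_neg_stdG (hIi v)), integral_comp_neg_stdG,
    integral_comp_neg_stdG, hAI, hAI]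
  ring

/-- The risk of soft thresholding is smallest at the origin. -/
lemma mul_nullRisk_le (θ : ℝ) {τ α : ℝ} (hτ : 0 < τ) (hα : 0 ≤ α) :
    τ ^ 2 * nullRisk α ≤ ∫ z, (eta (θ + τ * z) (τ * α) - θ) ^ 2 ∂stdG := by
  have hb : 0 ≤ τ * α := by positivity
  set f : ℝ → ℝ := fun z => (eta (θ + τ * z) (τ * α) - θ) ^ 2 with hf
  have hfi : Integrable f stdG := integrable_eta_sub_sq θ τ hb
  have key : ∫ z, 2 * (τ ^ 2 * (max (|z| - α) 0) ^ 2) ∂stdG ≤ ∫ z, (f z + f (-z)) ∂stdG := by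
    refine integral_mono (((integrable_nullRisk hα).const_mul _).const_mul _)
      (hfi.add (integrable_comp_neg_stdG hfi)) fun z => ?_
    have h (y : ℝ) : τ ^ 2 * (max (|y| - α) 0) ^ 2 ≤ f y := by
      simp only [hf]
      rw [← mul_pow, eta_eq_sub_clamp _ hb, sq_le_sq,
        abs_of_nonneg (mul_nonneg hτ.le (le_max_right _ _))]
      set c := max (-(τ * α)) (min (τ * α) (θ + τ * y)) with hc
      have hcb : |c| ≤ τ * α :=
        abs_le.2 ⟨le_max_left _ _, max_le (by linarith) (min_le_left _ _)⟩
      have hab : τ * |y| - |c| ≤ |θ + τ * y - c - θ| := by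
        have h := abs_sub_abs_le_abs_sub (τ * y) c
        rw [abs_mul, abs_of_pos hτ] at h
        rwa [show θ + τ * y - c - θ = τ * y - c by ring]
      rcases le_total (|y| - α) 0 with h0 | h0
      · rw [max_eq_right h0]; simp
      · rw [max_eq_left h0, mul_sub]; linarith
    have h1 := h z
    have h2 := h (-z)
    rw [abs_neg] at h2
    linarith
  rw [integral_add hfi (integrable_comp_neg_stdG hfi), integral_comp_neg_stdG,
    integral_const_mul, integral_const_mul] at key
  change _ ≤ ∫ z, f z ∂stdG
  unfold nullRisk
  linarith

/-- A dual certificate bounds the correlation of the thresholding error with the noise: the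
subgradient `sign θ` is used on entries larger than `t`, and the clipped noise on the others. -/
lemma tau_mul_integral_eta'_le (θ : ℝ) {τ b α t : ℝ} (hτ : 0 < τ) (hb : 0 < b) (hα : 0 < α)
    (ht : 0 ≤ t) :
    τ * ∫ z, eta' (θ + τ * z) b ∂stdG ≤
      (τ * (if t < |θ| then 1 + α ^ 2 else nullRisk α) +
        (∫ z, (eta (θ + τ * z) b - θ) ^ 2 ∂stdG) / τ) / 2 +
      α / b * (τ * (τ * ∫ z, eta' (θ + τ * z) b ∂stdG) -
        ∫ z, (eta (θ + τ * z) b - θ) ^ 2 ∂stdG) + 2 * α * t := by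
  set w : ℝ → ℝ := fun z => eta (θ + τ * z) b - θ with hw
  have hwi : Integrable (fun z => w z ^ 2) stdG := integrable_eta_sub_sq θ τ hb.le
  have hzwi : Integrable (fun z => z * w z) stdG := integrable_mul_eta_sub θ τ hb.le
  have hprox (z : ℝ) : α * (|w z + θ| - |θ|) ≤ α / b * (τ * (z * w z) - w z ^ 2) := by
    have h := mul_abs_eta_sub_abs_le (θ + τ * z) θ hb.le
    have h1 : eta (θ + τ * z) b = w z + θ := by simp [hw]
    rw [h1] at h
    calc α * (|w z + θ| - |θ|) = α / b * (b * (|w z + θ| - |θ|)) := by field_simp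
      _ ≤ α / b * (τ * (z * w z) - w z ^ 2) := by
        gcongr
        linarith
  have hyoung (x y : ℝ) : x * y ≤ (τ * x ^ 2 + y ^ 2 / τ) / 2 := by
    have h : (τ * x ^ 2 + y ^ 2 / τ) / 2 - x * y = (τ * x - y) ^ 2 / (2 * τ) := by
      field_simp; ring
    have : 0 ≤ (τ * x - y) ^ 2 / (2 * τ) := by positivity
    linarith
  obtain ⟨h, hhi, hhint, hh⟩ : ∃ h : ℝ → ℝ, Integrable h stdG ∧
      ∫ z, h z ∂stdG = (if t < |θ| then 1 + α ^ 2 else nullRisk α) ∧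
      ∀ z, z * w z ≤ (τ * h z + w z ^ 2 / τ) / 2 + α * (|w z + θ| - |θ|) + 2 * α * t := by
    split_ifs with hθ
    · refine ⟨fun z => (z - α * Real.sign θ) ^ 2, integrable_sub_sq_stdG _, ?_, fun z => ?_⟩
      · have hs : Real.sign θ ^ 2 = 1 := by
          rcases Real.sign_apply_eq_of_ne_zero θ (abs_pos.1 (ht.trans_lt hθ)) with h | h <;>
            rw [h] <;> norm_num
        rw [integral_sub_sq_stdG, mul_pow, hs, mul_one]
      · have h1 := hyoung (z - α * Real.sign θ) (w z)
        have h2 : Real.sign θ * w z ≤ |w z + θ| - |θ| := by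
          rcases lt_or_gt_of_ne (abs_pos.1 (ht.trans_lt hθ)) with h | h
          · rw [Real.sign_of_neg h, abs_of_neg h]
            linarith [neg_le_abs (w z + θ)]
          · rw [Real.sign_of_pos h, abs_of_pos h]
            linarith [le_abs_self (w z + θ)]
        have h3 := mul_le_mul_of_nonneg_left h2 hα.le
        have h4 : 0 ≤ 2 * α * t := by positivity
        linarith
    · refine ⟨fun z => (max (|z| - α) 0) ^ 2, integrable_nullRisk hα.le, rfl, fun z => ?_⟩
      set c := max (-α) (min α z) with hc
      have hcα : |c| ≤ α := abs_le.2 ⟨le_max_left _ _, max_le (by linarith) (min_le_left _ _)⟩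
      have h1 := hyoung (z - c) (w z)
      have h2 : (z - c) ^ 2 = (max (|z| - α) 0) ^ 2 := by
        rw [hc, ← eta_eq_sub_clamp z hα.le, eta, mul_pow]
        rcases eq_or_ne z 0 with rfl | hz
        · simp [hα.le]
        · rcases Real.sign_apply_eq_of_ne_zero z hz with h | h <;> rw [h] <;> ring
      have h3 : c * w z ≤ α * |w z| :=
        (le_abs_self _).trans
          (by rw [abs_mul]; exact mul_le_mul_of_nonneg_right hcα (abs_nonneg _))
      have h4 : |w z| ≤ |w z + θ| - |θ| + 2 * t := by
        have := abs_sub (w z + θ) θ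
        rw [add_sub_cancel_right] at this
        linarith
      have h5 := mul_le_mul_of_nonneg_left h4 hα.le
      rw [h2] at h1
      linarith
  have hS := integral_mul_eta_sub θ hτ hb
  have hi1 : Integrable (fun z => (τ * h z + w z ^ 2 / τ) / 2) stdG :=
    ((hhi.const_mul τ).add (hwi.div_const τ)).div_const 2
  have hi2 : Integrable (fun z => α / b * (τ * (z * w z) - w z ^ 2)) stdG :=
    ((hzwi.const_mul τ).sub hwi).const_mul _
  have hi12 : Integrable (fun z => (τ * h z + w z ^ 2 / τ) / 2 +
      α / b * (τ * (z * w z) - w z ^ 2)) stdG := hi1.add hi2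
  have hm : ∫ z, z * w z ∂stdG ≤ ∫ z, ((τ * h z + w z ^ 2 / τ) / 2 +
      α / b * (τ * (z * w z) - w z ^ 2) + 2 * α * t) ∂stdG := by
    refine integral_mono hzwi (hi12.add (integrable_const _)) fun z => ?_
    have h1 := hh z
    have h2 := hprox z
    dsimp only
    linarith
  rw [integral_add hi12 (integrable_const _), integral_add hi1 hi2, integral_div,
    integral_add (hhi.const_mul τ) (hwi.div_const τ), integral_const_mul, integral_const_mul,
    integral_sub (hzwi.const_mul τ) hwi, integral_const_mul, integral_div, hhint] at hm
  change ∫ z, z * w z ∂stdG = _ at hS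
  rw [hS] at hm
  simpa using hm

lemma integral_eta'_le (θ : ℝ) {τ b t k : ℝ} (hτ : 0 < τ) (hk : 0 < k) (hb : t + τ * k ≤ b) :
    ∫ z, eta' (θ + τ * z) b ∂stdG ≤ (if t < |θ| then 1 else 0) + 1 / k ^ 2 := by
  have hm : ∫ z, eta' (θ + τ * z) b ∂stdG ≤
      ∫ z, ((if t < |θ| then 1 else 0) + z ^ 2 / k ^ 2) ∂stdG := by
    refine integral_mono (integrable_eta' θ τ b)
      ((integrable_const _).add ((integrable_pow_stdG 2).div_const _)) fun z => ?_
    have h0 : 0 ≤ z ^ 2 / k ^ 2 := by positivity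
    simp only [eta']
    split_ifs with h1 h2
    · linarith
    · have h3 := abs_add_le θ (τ * z)
      rw [abs_mul, abs_of_pos hτ] at h3
      have h4 : k ≤ |z| := by
        by_contra! h
        have := mul_lt_mul_of_pos_left h hτ
        linarith
      rw [zero_add, one_le_div (by positivity), ← sq_abs z]
      exact pow_le_pow_left₀ hk.le h4 2
    · linarith
    · linarith
  rw [integral_add (integrable_const _) ((integrable_pow_stdG 2).div_const _), integral_div,
    integral_sq_stdG] at hm
  simpa using hm

/-! ### Averages over the empirical distribution -/

lemma integral_empDist_prod {N : ℕ} (θ : Fin N → ℝ) {f : ℝ × ℝ → ℝ} (hf : Measurable f)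
    (hi : ∀ i, Integrable (fun z => f (θ i, z)) stdG) :
    ∫ q, f q ∂((empDist θ).prod stdG) = (1 / (N : ℝ)) * ∑ i, ∫ z, f (θ i, z) ∂stdG := by
  have hprod : (empDist θ).prod stdG =
      (N : ℝ≥0∞)⁻¹ • ∑ i, stdG.map (Prod.mk (θ i)) := by
    rw [empDist, Measure.prod_smul_left, ← Measure.sum_fintype, Measure.prod_sum_left,
      Measure.sum_fintype]
    simp only [Measure.dirac_prod]
  rw [hprod, integral_smul_measure, integral_finsetSum_measure]
  · simp only [ENNReal.toReal_inv, ENNReal.toReal_natCast, smul_eq_mul, one_div]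
    congr 1
    refine Finset.sum_congr rfl fun i _ => ?_
    rw [integral_map (by fun_prop) hf.aestronglyMeasurable]
  · intro i _
    rw [integrable_map_measure hf.aestronglyMeasurable (by fun_prop)]
    exact hi i

lemma integral_eta_sub_sq_empDist {N : ℕ} (θ : Fin N → ℝ) (τ : ℝ) {b : ℝ} (hb : 0 ≤ b) :
    ∫ q : ℝ × ℝ, (eta (q.1 + τ * q.2) b - q.1) ^ 2 ∂((empDist θ).prod stdG) =
      (1 / (N : ℝ)) * ∑ i, ∫ z, (eta (θ i + τ * z) b - θ i) ^ 2 ∂stdG := by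
  refine integral_empDist_prod θ (f := fun q => (eta (q.1 + τ * q.2) b - q.1) ^ 2) ?_
    fun i => integrable_eta_sub_sq (θ i) τ hb
  simp only [eta_eq_sub_clamp _ hb]
  fun_prop

lemma integral_eta'_empDist {N : ℕ} (θ : Fin N → ℝ) (τ b : ℝ) :
    ∫ q : ℝ × ℝ, eta' (q.1 + τ * q.2) b ∂((empDist θ).prod stdG) =
      (1 / (N : ℝ)) * ∑ i, ∫ z, eta' (θ i + τ * z) b ∂stdG :=
  integral_empDist_prod θ (f := fun q => eta' (q.1 + τ * q.2) b)
    ((measurable_eta' b).comp (by fun_prop)) fun i => integrable_eta' (θ i) τ b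

/-! ### Approximately sparse classes -/

/-- Every vector of the class has at most `s N` entries larger than `t` in absolute value, and at
threshold `α` the worst-case risk of soft thresholding over `s`-sparse vectors is below `δ`. -/
def ApproxSparse (δ : ℝ) (D : (M : ℕ) → Set (Fin M → ℝ)) (s α t : ℝ) : Prop :=
  0 ≤ s ∧ s ≤ 1 ∧ 0 < α ∧ 0 ≤ t ∧ s * (1 + α ^ 2) + (1 - s) * nullRisk α < δ ∧
    ∀ N : ℕ, 0 < N → ∀ θ ∈ D N, ((Finset.univ.filter fun i => t < |θ i|).card : ℝ) ≤ s * N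

lemma exists_approxSparse_of_smax {δ s : ℝ} (hδ : 0 < δ) (hs : 0 ≤ s) (hsm : s < smax δ) :
    ∃ s' α t, ApproxSparse δ (fun M => F0ball M s) s' α t := by
  have hcard (N : ℕ) (θ : Fin N → ℝ) :
      Finset.univ.filter (fun i => 0 < |θ i|) = Finset.univ.filter fun i => θ i ≠ 0 := by
    simp only [abs_pos]
  rcases lt_or_ge 1 δ with hδ1 | hδ1
  · refine ⟨1, Real.sqrt ((δ - 1) / 2), 0, zero_le_one, le_rfl, Real.sqrt_pos.2 (by linarith),
      le_rfl, ?_, fun N _ θ _ => ?_⟩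
    · rw [Real.sq_sqrt (by linarith)]
      linarith
    · rw [one_mul]
      exact_mod_cast (Finset.card_le_univ _).trans (Fintype.card_fin N).le
  · rw [smax, mul_comm, ← div_lt_iff₀ hδ] at hsm
    obtain ⟨_, ⟨α, hα, rfl⟩, h⟩ := exists_lt_of_lt_csSup (Set.nonempty_Ici.image _) hsm
    have hα : 0 ≤ α := hα
    have hR := nullRisk_eq hα
    have hR1 := nullRisk_le_one hα
    have hR0 := nullRisk_nonneg α
    have hnum : 1 - (2 / δ) * ((1 + α ^ 2) * gPhi (-α) - α * gphi α) = 1 - nullRisk α / δ := by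
      rw [hR]; ring
    simp only [hnum, ← hR] at h
    have hden : 0 < 1 + α ^ 2 - nullRisk α := by
      refine lt_of_le_of_ne (by nlinarith) fun h0 => ?_
      rw [← h0, div_zero] at h
      exact absurd h (not_lt.2 (div_nonneg hs hδ.le))
    rw [div_lt_div_iff₀ hδ hden, sub_mul, div_mul_cancel₀ _ hδ.ne', one_mul] at h
    have hs1 : s ≤ 1 := by
      by_contra! hs1
      nlinarith [sq_nonneg α]
    have hα0 : 0 < α := by
      refine lt_of_le_of_ne hα fun h0 => ?_
      subst h0
      rw [nullRisk_zero] at hden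
      norm_num at hden
    refine ⟨s, α, 0, hs, hs1, hα0, le_rfl, by linarith, fun N _ θ hθ => ?_⟩
    rw [hcard]
    exact hθ

lemma card_filter_le_of_mem_Fball {N : ℕ} (hN : 0 < N) {p ξ t : ℝ} (hp : 0 < p) (ht : 0 < t)
    {θ : Fin N → ℝ} (hθ : θ ∈ Fball N p ξ) :
    ((Finset.univ.filter fun i => t < |θ i|).card : ℝ) ≤ ξ ^ p / t ^ p * N := by
  have hN' : (0 : ℝ) < N := by exact_mod_cast hN
  have hθ : (1 / (N : ℝ)) * ∑ i, |θ i| ^ p ≤ ξ ^ p := hθ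
  have htp : 0 < t ^ p := Real.rpow_pos_of_pos ht p
  have h1 : ((Finset.univ.filter fun i => t < |θ i|).card : ℝ) * t ^ p ≤ ∑ i, |θ i| ^ p := by
    rw [← nsmul_eq_mul]
    refine (Finset.card_nsmul_le_sum _ (fun i => |θ i| ^ p) _ fun i hi => ?_).trans
      (Finset.sum_le_sum_of_subset_of_nonneg (Finset.filter_subset _ _) fun i _ _ => by positivity)
    exact Real.rpow_le_rpow ht.le (Finset.mem_filter.1 hi).2.le hp.le
  rw [one_div, inv_mul_le_iff₀ hN'] at hθ
  rw [div_mul_eq_mul_div, le_div_iff₀ htp]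
  linarith

lemma exists_approxSparse_of_Fball {δ p ξ : ℝ} (hδ : 0 < δ) (hp : 0 < p) (hξ : 0 < ξ) :
    ∃ s α t, ApproxSparse δ (fun M => Fball M p ξ) s α t := by
  obtain ⟨α, hα, hR⟩ := exists_nullRisk_lt (half_pos hδ)
  have hR0 := nullRisk_nonneg α
  set s : ℝ := min 1 (δ / (4 * (1 + α ^ 2))) with hs
  have hα2 : 0 < 1 + α ^ 2 := by positivity
  have hs0 : 0 < s := lt_min one_pos (by positivity)
  have hs1 : s ≤ 1 := min_le_left _ _
  have hsδ : s * (1 + α ^ 2) ≤ δ / 4 := by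
    have : s ≤ δ / (4 * (1 + α ^ 2)) := min_le_right _ _
    rw [le_div_iff₀ (by positivity)] at this
    linarith
  set t : ℝ := ξ * (1 / s) ^ (1 / p) with ht
  have ht0 : 0 < t := by positivity
  have htp : ξ ^ p / t ^ p = s := by
    rw [ht, Real.mul_rpow hξ.le (by positivity), ← Real.rpow_mul (by positivity),
      one_div_mul_cancel hp.ne', Real.rpow_one]
    have := Real.rpow_pos_of_pos hξ p
    field_simp
  refine ⟨s, α, t, hs0.le, hs1, hα, ht0.le, by nlinarith, fun N hN θ hθ => ?_⟩
  rw [← htp]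
  exact card_filter_le_of_mem_Fball hN hp ht0 hθ

lemma exists_approxSparse {δ q : ℝ} {D : (M : ℕ) → Set (Fin M → ℝ)} (hδ : 0 < δ)
    (hD : DFamSpec δ D q) : ∃ s α t, ApproxSparse δ D s α t := by
  rcases hD with ⟨p, ξ, hp, hξ, hD, -⟩ | ⟨s, hs, hsm, hD, -⟩
  · obtain rfl : D = fun M => Fball M p ξ := funext hD
    exact exists_approxSparse_of_Fball hδ hp hξ
  · obtain rfl : D = fun M => F0ball M s := funext hD
    exact exists_approxSparse_of_smax hδ hs hsm

/-- Averages of a function taking value `a` on large entries and `c ≤ a` on small ones. -/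
lemma average_ite_le {N : ℕ} (hN : 0 < N) (θ : Fin N → ℝ) {s t a c : ℝ} (hca : c ≤ a)
    (hθ : ((Finset.univ.filter fun i => t < |θ i|).card : ℝ) ≤ s * N) :
    (1 / (N : ℝ)) * ∑ i, (if t < |θ i| then a else c) ≤ s * a + (1 - s) * c := by
  have hN' : (0 : ℝ) < N := by exact_mod_cast hN
  have h : ∑ i, (if t < |θ i| then a else c) =
      ∑ i, ((a - c) * (if t < |θ i| then 1 else 0) + c) :=
    Finset.sum_congr rfl fun i _ => by split_ifs <;> ring
  rw [h, Finset.sum_add_distrib, ← Finset.mul_sum, Finset.sum_boole, one_div,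
    inv_mul_le_iff₀ hN']
  simp only [Finset.sum_const, Finset.card_univ, Fintype.card_fin, nsmul_eq_mul]
  nlinarith [mul_le_mul_of_nonneg_left hθ (sub_nonneg.2 hca)]

/-! ### Bounds on solutions of the state evolution equations -/

section StateEvolution

variable {δ σ lam β τ : ℝ} {N : ℕ} {θ : Fin N → ℝ}

lemma StateEvo.average_risk_eq (hδ : 0 < δ) (hlam : 0 < lam)
    (h : StateEvo δ σ (empDist θ) lam β τ) :
    (1 / (N : ℝ)) * ∑ i, ∫ z, (eta (θ i + τ * z) (τ * lam / β) - θ i) ^ 2 ∂stdG =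
      δ * (τ ^ 2 - σ ^ 2) := by
  obtain ⟨hβ, hτ, h1, -⟩ := h
  rw [integral_eta_sub_sq_empDist θ τ (by positivity)] at h1
  field_simp at h1 ⊢
  linarith

lemma StateEvo.average_active_eq (hδ : 0 < δ) (h : StateEvo δ σ (empDist θ) lam β τ) :
    τ * ((1 / (N : ℝ)) * ∑ i, ∫ z, eta' (θ i + τ * z) (τ * lam / β) ∂stdG) = δ * (τ - β) := by
  obtain ⟨hβ, hτ, -, h2⟩ := h
  rw [integral_eta'_empDist θ τ] at h2
  set P := (1 / (N : ℝ)) * ∑ i, ∫ z, eta' (θ i + τ * z) (τ * lam / β) ∂stdG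
  have : δ * β = τ * (δ - P) := by
    rw [h2]; field_simp
  linarith

lemma StateEvo.le_tau (hδ : 0 < δ) (hlam : 0 < lam) (h : StateEvo δ σ (empDist θ) lam β τ) :
    σ ≤ τ := by
  have h1 := h.average_risk_eq hδ hlam
  have h2 : 0 ≤ (1 / (N : ℝ)) *
      ∑ i, ∫ z, (eta (θ i + τ * z) (τ * lam / β) - θ i) ^ 2 ∂stdG :=
    mul_nonneg (by positivity)
      (Finset.sum_nonneg fun i _ => integral_nonneg fun z => sq_nonneg _)
  rw [h1] at h2
  have := nonneg_of_mul_nonneg_right h2 hδ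
  exact abs_le_of_sq_le_sq' (by linarith) h.2.1.le |>.2

lemma StateEvo.nullRisk_lt (hδ : 0 < δ) (hσ : 0 < σ) (hlam : 0 < lam) (hN : 0 < N)
    (h : StateEvo δ σ (empDist θ) lam β τ) : nullRisk (lam / β) < δ := by
  have h1 := h.average_risk_eq hδ hlam
  obtain ⟨hβ, hτ, -, -⟩ := h
  have hN' : (0 : ℝ) < N := by exact_mod_cast hN
  have h2 : τ ^ 2 * nullRisk (lam / β) ≤ (1 / (N : ℝ)) *
      ∑ i, ∫ z, (eta (θ i + τ * z) (τ * lam / β) - θ i) ^ 2 ∂stdG := by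
    rw [one_div, le_inv_mul_iff₀ hN', ← nsmul_eq_mul]
    have := Finset.card_nsmul_le_sum Finset.univ
      (fun i => ∫ z, (eta (θ i + τ * z) (τ * lam / β) - θ i) ^ 2 ∂stdG)
      (τ ^ 2 * nullRisk (lam / β)) fun i _ => by
        rw [mul_div_assoc]
        exact mul_nullRisk_le (θ i) hτ (by positivity)
    simpa using this
  rw [h1] at h2
  have h3 : 0 < δ * σ ^ 2 := by positivity
  have h4 : 0 < τ ^ 2 := by positivity
  by_contra! h5
  nlinarith

lemma StateEvo.lt_div (hδ : 0 < δ) (hσ : 0 < σ) (hlam : 0 < lam) (hN : 0 < N)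
    (h : StateEvo δ σ (empDist θ) lam β τ) {α : ℝ} (hα : 0 < α) (hαδ : nullRisk α = δ) :
    β < lam / α := by
  have h1 := h.nullRisk_lt hδ hσ hlam hN
  have hβ := h.1
  rw [lt_div_iff₀ hα, mul_comm, ← lt_div_iff₀ hβ]
  by_contra! h2
  have := nullRisk_anti (by positivity) h2
  linarith

lemma StateEvo.tau_le {s α t : ℝ} {D : (M : ℕ) → Set (Fin M → ℝ)} (hδ : 0 < δ) (hσ : 0 < σ)
    (hlam : 0 < lam) (hN : 0 < N) (hD : ApproxSparse δ D s α t) (hθ : θ ∈ D N)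
    (h : StateEvo δ σ (empDist θ) lam β τ) :
    τ * (δ - (s * (1 + α ^ 2) + (1 - s) * nullRisk α)) / 2 ≤
      δ * β + α * δ / lam * (β * σ - β ^ 2) + 2 * α * t := by
  obtain ⟨hs0, hs1, hα, ht, hM, hcard⟩ := hD
  have hrisk := h.average_risk_eq hδ hlam
  have hact := h.average_active_eq hδ
  have hστ := h.le_tau hδ hlam
  obtain ⟨hβ, hτ, -, -⟩ := h
  have hN' : (0 : ℝ) < N := by exact_mod_cast hN
  have hb : 0 < τ * lam / β := by positivity
  set b := τ * lam / β with hb_def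
  have hM' := average_ite_le hN θ (a := 1 + α ^ 2) (c := nullRisk α)
    (by nlinarith [nullRisk_le_one hα.le]) (hcard N hN θ hθ)
  have hsum := Finset.sum_le_sum fun i (_ : i ∈ Finset.univ) =>
    tau_mul_integral_eta'_le (θ i) hτ hb hα ht
  simp only [Finset.sum_add_distrib, Finset.sum_sub_distrib, ← Finset.mul_sum,
    ← Finset.sum_div, Finset.sum_const, Finset.card_univ, Fintype.card_fin, nsmul_eq_mul] at hsum
  set A := ∑ i, ∫ z, (eta (θ i + τ * z) b - θ i) ^ 2 ∂stdG
  set P := ∑ i, ∫ z, eta' (θ i + τ * z) b ∂stdG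
  set H := ∑ i, (if t < |θ i| then 1 + α ^ 2 else nullRisk α)
  set M := s * (1 + α ^ 2) + (1 - s) * nullRisk α
  have h1 : δ * (τ - β) ≤ (τ * ((1 / N) * H) + δ * (τ ^ 2 - σ ^ 2) / τ) / 2 +
      α / b * (τ * (δ * (τ - β)) - δ * (τ ^ 2 - σ ^ 2)) + 2 * α * t := by
    rw [← hact, ← hrisk]
    calc τ * (1 / N * P) = (1 / N) * (τ * P) := by ring
      _ ≤ (1 / N) * _ := mul_le_mul_of_nonneg_left hsum (by positivity)
      _ = _ := by field_simp
  have h2 : τ * ((1 / N) * H) ≤ τ * M := mul_le_mul_of_nonneg_left hM' hτ.le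
  have h3 : δ * (τ ^ 2 - σ ^ 2) / τ ≤ δ * τ := by
    rw [div_le_iff₀ hτ]
    nlinarith [mul_pos hδ (pow_pos hσ 2)]
  have h4 : α / b * (τ * (δ * (τ - β)) - δ * (τ ^ 2 - σ ^ 2)) ≤
      α * δ / lam * (β * σ - β ^ 2) := by
    have : α / b * (τ * (δ * (τ - β)) - δ * (τ ^ 2 - σ ^ 2)) =
        α * δ / lam * (β * (σ ^ 2 / τ) - β ^ 2) := by
      rw [hb_def]; field_simp; ring
    rw [this]
    gcongr
    rw [div_le_iff₀ hτ]
    nlinarith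
  linarith

lemma StateEvo.le_beta {s t k : ℝ} (hδ : 0 < δ) (hσ : 0 < σ) (hlam : 0 < lam) (hN : 0 < N)
    (ht : 0 ≤ t) (hk : 0 < k)
    (hcard : ((Finset.univ.filter fun i => t < |θ i|).card : ℝ) ≤ s * N)
    (hsk : s + 1 / k ^ 2 ≤ δ)
    (h : StateEvo δ σ (empDist θ) lam β τ) :
    min (σ * (δ - (s + 1 / k ^ 2)) / δ) (lam / (t / σ + k)) ≤ β := by
  have hact := h.average_active_eq hδ
  have hστ := h.le_tau hδ hlam
  obtain ⟨hβ, hτ, -, -⟩ := h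
  have hN' : (0 : ℝ) < N := by exact_mod_cast hN
  rcases le_total (t + τ * k) (τ * lam / β) with hb | hb
  · refine (min_le_left _ _).trans ?_
    have hsum := Finset.sum_le_sum fun i (_ : i ∈ Finset.univ) =>
      integral_eta'_le (θ i) hτ hk hb
    have havg := average_ite_le hN θ (zero_le_one (α := ℝ)) hcard
    rw [Finset.sum_add_distrib] at hsum
    simp only [Finset.sum_const, Finset.card_univ, Fintype.card_fin, nsmul_eq_mul] at hsum
    set P := ∑ i, ∫ z, eta' (θ i + τ * z) (τ * lam / β) ∂stdG
    set H : ℝ := ∑ i, (if t < |θ i| then 1 else 0)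
    have h1 : 1 / (N : ℝ) * P ≤ s + 1 / k ^ 2 := by
      calc 1 / (N : ℝ) * P ≤ 1 / N * (H + N * (1 / k ^ 2)) :=
            mul_le_mul_of_nonneg_left hsum (by positivity)
        _ = 1 / N * H + 1 / k ^ 2 := by field_simp
        _ ≤ s + 1 / k ^ 2 := by linarith
    have h2 := mul_le_mul_of_nonneg_left h1 hτ.le
    have h3 := mul_le_mul_of_nonneg_right hστ (sub_nonneg.2 hsk)
    rw [div_le_iff₀ hδ]
    linarith
  · refine (min_le_right _ _).trans ?_
    have h1 : t + τ * k ≤ τ * (t / σ + k) := by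
      have : t = σ * (t / σ) := by field_simp
      have := mul_le_mul_of_nonneg_right hστ (div_nonneg ht hσ.le)
      linarith
    have h2 := hb.trans h1
    rw [mul_div_assoc] at h2
    have h3 := le_of_mul_le_mul_left h2 hτ
    rw [div_le_iff₀ hβ] at h3
    rw [div_le_iff₀ (by positivity)]
    linarith

end StateEvolution

theorem stmt16 (δ σ lmin lmax q : ℝ)
    (hδ : 0 < δ) (hσ : 0 < σ) (hl : 0 < lmin) (hll : lmin ≤ lmax)
    (Dfam : (M : ℕ) → Set (Fin M → ℝ))
    (hD : DFamSpec δ Dfam q) :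
    ∃ βmin τmax : ℝ, 0 < βmin ∧ 0 < τmax ∧
      ∀ (N n : ℕ), 0 < N → (n : ℝ) = δ * N →
      ∀ θstar ∈ Dfam N,
      ∀ lam ∈ Set.Icc lmin lmax,
      ∀ β τ : ℝ, StateEvo δ σ (empDist θstar) lam β τ →
        βmin ≤ β ∧ σ ≤ τ ∧ τ ≤ τmax ∧
        (δ < 1 →
          ∀ α : ℝ, 0 < α → (1 + α ^ 2) * gPhi (-α) - α * gphi α = δ / 2 →
            β < lmax / α) := by
  obtain ⟨s, α, t, hsp⟩ := exists_approxSparse hδ hD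
  obtain ⟨hs0, hs1, hα, ht, hM, hcard⟩ := id hsp
  have hlM : 0 < lmax := hl.trans_le hll
  have hR0 := nullRisk_nonneg α
  have hsδ : s < δ := by nlinarith [mul_nonneg hs0 (sq_nonneg α)]
  set M := s * (1 + α ^ 2) + (1 - s) * nullRisk α
  have hMδ : 0 < δ - M := sub_pos.2 hM
  have hε : 0 < 2 / (δ - s) := div_pos two_pos (sub_pos.2 hsδ)
  set k := Real.sqrt (2 / (δ - s))
  have hk : 0 < k := Real.sqrt_pos.2 hε
  have hk2 : 1 / k ^ 2 = (δ - s) / 2 := by rw [Real.sq_sqrt hε.le, one_div_div]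
  set K := (1 + α * σ / lmin) ^ 2 * lmax / (4 * α)
  have hK : 0 < K := by positivity
  refine ⟨min (σ * (δ - (s + 1 / k ^ 2)) / δ) (lmin / (t / σ + k)),
    2 * (δ * K + 2 * α * t) / (δ - M), lt_min ?_ (by positivity), by positivity, ?_⟩
  · rw [hk2]
    exact div_pos (mul_pos hσ (by linarith)) hδ
  intro N n hN _ θ hθ lam hlam β τ h
  have hlam0 : 0 < lam := hl.trans_le hlam.1
  refine ⟨?_, h.le_tau hδ hlam0, ?_, fun _ a ha haδ => ?_⟩
  · exact le_trans (min_le_min_left _ (div_le_div_of_nonneg_right hlam.1 (by positivity)))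
      (h.le_beta hδ hσ hlam0 hN ht hk (hcard N hN θ hθ) (by rw [hk2]; linarith))
  · have h1 := h.tau_le hδ hσ hlam0 hN hsp hθ
    have hβ := h.1
    have h2 : β + α / lam * (β * σ - β ^ 2) ≤ (1 + α * σ / lam) ^ 2 * lam / (4 * α) := by
      have : (1 + α * σ / lam) ^ 2 * lam / (4 * α) - (β + α / lam * (β * σ - β ^ 2)) =
          (lam + α * σ - 2 * α * β) ^ 2 / (4 * α * lam) := by
        field_simp; ring
      have h0 : 0 ≤ (lam + α * σ - 2 * α * β) ^ 2 / (4 * α * lam) := by positivity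
      linarith
    have h3 : (1 + α * σ / lam) ^ 2 * lam / (4 * α) ≤ K := by
      obtain ⟨hlo, hhi⟩ := hlam
      simp only [K]
      gcongr
    have h4 := mul_le_mul_of_nonneg_left (h2.trans h3) hδ.le
    have h5 : δ * (β + α / lam * (β * σ - β ^ 2)) =
        δ * β + α * δ / lam * (β * σ - β ^ 2) := by ring
    rw [le_div_iff₀ hMδ]
    linarith
  · have h1 : nullRisk a = δ := by rw [nullRisk_eq ha.le, haδ]; ring
    exact (h.lt_div hδ hσ hlam0 hN ha h1).trans_le (by gcongr; exact hlam.2)
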